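/- The Nash optimum (n/2)-approximates the egalitarian social welfare: for every profile x ∈ [0,1]^n (n ≥ 2) and every Nash optimum y* for x, and for every y ∈ [0,1], ESW(y, x) ≤ (n/2)·ESW(y*, x). Moreover this bound is tight: there exists a profile x ∈ [0,1]^n and a Nash optimum y* for x such that ESW(Mid(x), x) = (n/2)·ESW(y*, x). -/

import Mathlib

open Set

noncomputable section

/-- Utility of an agent at location `z` when the facility is at `y`. -/
def util (y z : ℝ) : ℝ := 1 - |y - z|

/-- Nash welfare: product of agents' utilities. -/
def nash {n : ℕ} (y : ℝ) (x : Fin n → ℝ) : ℝ := ∏ i, util y (x i)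

/-- `y` is a Nash optimum for the profile `x`. -/
def isNashOpt {n : ℕ} (x : Fin n → ℝ) (y : ℝ) : Prop :=
  y ∈ Set.Icc (0 : ℝ) 1 ∧ ∀ z ∈ Set.Icc (0 : ℝ) 1, nash z x ≤ nash y x

/-- Egalitarian social welfare: minimum utility of an agent. -/
def esw {n : ℕ} (y : ℝ) (x : Fin n → ℝ) : ℝ := ⨅ i, util y (x i)

/-- The midpoint mechanism. -/
def mid {n : ℕ} (x : Fin n → ℝ) : ℝ := ((⨅ i, x i) + (⨆ i, x i)) / 2

theorem util_reflect (y z : ℝ) : util (1 - y) (1 - z) = util y z := by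
  unfold util
  rw [sub_sub_sub_cancel_left, abs_sub_comm]

theorem nash_reflect {n : ℕ} (y : ℝ) (x : Fin n → ℝ) :
    nash (1 - y) (fun i => 1 - x i) = nash y x := by
  simp only [nash, util_reflect]

theorem isNashOpt.reflect {n : ℕ} {x : Fin n → ℝ} {y : ℝ} (h : isNashOpt x y) :
    isNashOpt (fun i => 1 - x i) (1 - y) := by
  refine ⟨⟨by linarith [h.1.2], by linarith [h.1.1]⟩, fun z hz => ?_⟩
  have hle := h.2 (1 - z) ⟨by linarith [hz.2], by linarith [hz.1]⟩
  rw [nash_reflect]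
  rwa [← nash_reflect, sub_sub_cancel] at hle

theorem esw_le_util {n : ℕ} (y : ℝ) (x : Fin n → ℝ) (i : Fin n) : esw y x ≤ util y (x i) :=
  ciInf_le (Set.finite_range _).bddBelow i

theorem util_nonneg {y z : ℝ} (hy : y ∈ Set.Icc (0 : ℝ) 1) (hz : z ∈ Set.Icc (0 : ℝ) 1) :
    0 ≤ util y z := by
  have : |y - z| ≤ 1 := abs_le.2 ⟨by linarith [hy.1, hz.2], by linarith [hy.2, hz.1]⟩
  unfold util
  linarith

/-- Every agent has positive utility at a Nash optimum. -/
theorem isNashOpt.util_pos {n : ℕ} {x : Fin n → ℝ} {y : ℝ} (h : isNashOpt x y)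
    (hx : ∀ i, x i ∈ Set.Icc (0 : ℝ) 1) (i : Fin n) : 0 < util y (x i) := by
  refine lt_of_le_of_ne (util_nonneg h.1 (hx i)) fun h0 => ?_
  have hpos : 0 < nash (1 / 2) x := Finset.prod_pos fun j _ => by
    have : |1 / 2 - x j| ≤ 1 / 2 :=
      abs_le.2 ⟨by linarith [(hx j).2], by linarith [(hx j).1]⟩
    unfold util
    linarith
  have hzero : nash y x = 0 := Finset.prod_eq_zero (Finset.mem_univ i) h0.symm
  linarith [h.2 (1 / 2) ⟨by norm_num, by norm_num⟩]

/-- A Nash optimum does not lie to the left of the leftmost agent. -/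
theorem isNashOpt.leftmost_le {n : ℕ} {x : Fin n → ℝ} {y : ℝ} (h : isNashOpt x y)
    (hx : ∀ i, x i ∈ Set.Icc (0 : ℝ) 1) {k : Fin n} (hk : ∀ j, x k ≤ x j) : x k ≤ y := by
  by_contra! hlt
  refine (h.2 (x k) (hx k)).not_gt ?_
  refine Finset.prod_lt_prod_of_nonempty (fun j _ => h.util_pos hx j) (fun j _ => ?_)
    ⟨k, Finset.mem_univ k⟩
  unfold util
  rw [abs_of_nonpos (by linarith [hk j]), abs_of_nonpos (by linarith [hk j])]
  linarith

/-- Moving the facility right by `t` shrinks the utility of an agent at `z ≥ a` by at most the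
factor `1 - t / L`, where `L` is the utility of an agent at `a`. -/
theorem util_add_ge {y a z t : ℝ} (ha : a ≤ y) (haz : a ≤ z) (hz : 0 ≤ util y z) (ht : 0 ≤ t)
    (htL : t ≤ 1 - (y - a)) (hL : 0 < 1 - (y - a)) :
    (1 - t / (1 - (y - a))) * util y z ≤ util (y + t) z := by
  set L := 1 - (y - a) with hLdef
  have h0 : 0 ≤ t / L := by positivity
  have h1 : t / L ≤ 1 := (div_le_one hL).2 htL
  have htt : t ≤ t / L := le_div_self ht hL (by linarith)
  have hmul : t / L * L = t := div_mul_cancel₀ _ hL.ne'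
  unfold util at hz ⊢
  rcases le_total z y with hzy | hzy
  · rw [abs_of_nonneg (by linarith)] at hz ⊢
    rw [abs_of_nonneg (by linarith)]
    nlinarith
  · rw [abs_of_nonpos (by linarith)] at hz ⊢
    rcases le_total z (y + t) with hzt | hzt
    · rw [abs_of_nonneg (by linarith)]
      nlinarith
    · rw [abs_of_nonpos (by linarith)]
      nlinarith

/-- First-order optimality: at a Nash optimum, the leftmost agent has at most `n - 1` times the
utility of any agent to the right of the optimum. -/
theorem isNashOpt.util_leftmost_le {n : ℕ} (hn : 2 ≤ n) {x : Fin n → ℝ} {y : ℝ}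
    (h : isNashOpt x y) (hx : ∀ i, x i ∈ Set.Icc (0 : ℝ) 1) {k i : Fin n}
    (hk : ∀ j, x k ≤ x j) (hi : y < x i) :
    1 - (y - x k) ≤ ((n : ℝ) - 1) * (1 - (x i - y)) := by
  have hky := h.leftmost_le hx hk
  have hu : util y (x i) = 1 - (x i - y) := by
    unfold util
    rw [abs_of_neg (by linarith)]
    ring
  have hL : 0 < 1 - (y - x k) := by
    have := h.util_pos hx k
    unfold util at this
    rwa [abs_of_nonneg (by linarith)] at this
  have hui := hu ▸ h.util_pos hx i
  by_contra! hlt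
  have hn' : (2 : ℝ) ≤ n := by exact_mod_cast hn
  set N : ℝ := (n : ℝ) - 1 with hN
  set u := 1 - (x i - y) with hu'
  set L := 1 - (y - x k) with hL'
  have hN1 : 1 ≤ N := by linarith
  obtain ⟨t, ht0, ht⟩ := exists_between
    (lt_min (sub_pos.2 hi) (div_pos (sub_pos.2 hlt) (by linarith : 0 < N)))
  obtain ⟨htd, htN⟩ := lt_min_iff.1 ht
  rw [lt_div_iff₀ (by linarith)] at htN
  have htL : t ≤ L := by nlinarith
  refine (h.2 (y + t) ⟨by linarith [h.1.1], by linarith [(hx i).2]⟩).not_gt ?_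
  have hti : util (y + t) (x i) = u + t := by
    unfold util
    rw [abs_of_neg (by linarith), hu']
    ring
  have hone : 0 ≤ 1 - t / L := sub_nonneg.2 ((div_le_one hL).2 htL)
  set P := ∏ j ∈ Finset.univ.erase i, util y (x j)
  have hP : 0 < P := Finset.prod_pos fun j _ => h.util_pos hx j
  have hprod : (1 - t / L) ^ (n - 1) * P ≤ ∏ j ∈ Finset.univ.erase i, util (y + t) (x j) := by
    have hcard : (Finset.univ.erase i).card = n - 1 := by simp
    rw [← hcard, ← Finset.prod_const, ← Finset.prod_mul_distrib]
    exact Finset.prod_le_prod (fun j _ => mul_nonneg hone (h.util_pos hx j).le)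
      fun j _ => util_add_ge hky (hk j) (h.util_pos hx j).le ht0.le htL hL
  have hbern : 1 - N * (t / L) ≤ (1 - t / L) ^ (n - 1) := by
    have := one_add_mul_le_pow (a := -(t / L)) (by linarith) (n - 1)
    rw [Nat.cast_sub (by omega), Nat.cast_one, ← sub_eq_add_neg] at this
    linarith
  have hgain : u < (u + t) * (1 - N * (t / L)) := by
    have : (u + t) * (1 - N * (t / L)) - u = t * (L - N * u - t * N) / L := by
      field_simp
      ring
    have : 0 < t * (L - N * u - t * N) / L :=
      div_pos (mul_pos ht0 (by linarith)) hL
    linarith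
  unfold nash
  rw [← Finset.mul_prod_erase _ _ (Finset.mem_univ i),
    ← Finset.mul_prod_erase _ (fun j => util (y + t) (x j)) (Finset.mem_univ i), hu, hti]
  calc u * P < (u + t) * (1 - N * (t / L)) * P := by gcongr
    _ ≤ (u + t) * ((1 - t / L) ^ (n - 1) * P) := by
      rw [mul_assoc]
      gcongr
    _ ≤ _ := by gcongr

theorem isNashOpt.esw_le_of_lt {n : ℕ} (hn : 2 ≤ n) {x : Fin n → ℝ} {y : ℝ}
    (h : isNashOpt x y) (hx : ∀ i, x i ∈ Set.Icc (0 : ℝ) 1) {i : Fin n} (hi : y < x i) (z : ℝ) :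
    esw z x ≤ (n : ℝ) / 2 * util y (x i) := by
  have : Nonempty (Fin n) := ⟨i⟩
  obtain ⟨k, hk⟩ := Finite.exists_min x
  have hle := h.util_leftmost_le hn hx hk hi
  have hzi := esw_le_util z x i
  have hzk := esw_le_util z x k
  unfold util at hzi hzk ⊢
  rw [abs_of_neg (by linarith)]
  linarith [neg_abs_le (z - x i), le_abs_self (z - x k)]

theorem isNashOpt.esw_le {n : ℕ} (hn : 2 ≤ n) {x : Fin n → ℝ} {y : ℝ}
    (h : isNashOpt x y) (hx : ∀ i, x i ∈ Set.Icc (0 : ℝ) 1) (z : ℝ) :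
    esw z x ≤ (n : ℝ) / 2 * esw y x := by
  have : Nonempty (Fin n) := ⟨⟨0, by omega⟩⟩
  obtain ⟨i, hi⟩ := exists_eq_ciInf_of_finite (f := fun i => util y (x i))
  have hi : esw y x = util y (x i) := hi.symm
  rw [hi]
  rcases lt_trichotomy y (x i) with hlt | heq | hgt
  · exact h.esw_le_of_lt hn hx hlt z
  · have hn' : (2 : ℝ) ≤ n := by exact_mod_cast hn
    have hz := esw_le_util z x i
    simp only [util, heq, sub_self, abs_zero] at hz ⊢
    linarith [abs_nonneg (z - x i)]
  · have hle := h.reflect.esw_le_of_lt hn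
      (fun j => ⟨by linarith [(hx j).2], by linarith [(hx j).1]⟩) (sub_lt_sub_left hgt 1) (1 - z)
    simpa only [esw, util_reflect] using hle

theorem mul_one_sub_pow_le (m : ℕ) {z : ℝ} (hz : z ≤ 1) :
    z * (1 - z) ^ (m + 1) ≤ 1 / (m + 2) * (1 - 1 / (m + 2)) ^ (m + 1) := by
  have hc : 1 - 1 / ((m : ℝ) + 2) = (m + 1) / (m + 2) := by
    field_simp
    ring
  rw [hc]
  rcases hz.eq_or_lt with rfl | hz
  · simp only [sub_self, ne_eq, Nat.add_eq_zero_iff, one_ne_zero, and_false, not_false_eq_true,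
      zero_pow, mul_zero]
    positivity
  have hb : 0 < 1 - z := sub_pos.2 hz
  set c : ℝ := (m + 1) / (m + 2) with hcdef
  have hc0 : 0 < c := by positivity
  have hbern := one_add_mul_le_pow (a := c / (1 - z) - 1)
    (by linarith [div_pos hc0 hb]) (m + 2)
  rw [add_sub_cancel, div_pow, le_div_iff₀ (by positivity)] at hbern
  have hl : (1 + ((m + 2 : ℕ) : ℝ) * (c / (1 - z) - 1)) * (1 - z) ^ (m + 2)
      = (m + 1) * (z * (1 - z) ^ (m + 1)) := by
    rw [pow_succ _ (m + 1), hcdef]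
    push_cast
    field_simp
    ring
  have hr : c ^ (m + 2) = (m + 1) * (1 / (m + 2) * c ^ (m + 1)) := by
    rw [pow_succ c (m + 1)]
    nth_rewrite 2 [hcdef]
    field_simp
  rw [hl, hr] at hbern
  exact le_of_mul_le_mul_left hbern (by positivity)

/-- The profile with one agent at `1` and all others at `0`. -/
def extremeProfile (m : ℕ) : Fin (m + 2) → ℝ := Fin.cons 1 fun _ => 0

theorem nash_extremeProfile (m : ℕ) {z : ℝ} (hz : z ∈ Set.Icc (0 : ℝ) 1) :
    nash z (extremeProfile m) = z * (1 - z) ^ (m + 1) := by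
  have h1 : |z - 1| = 1 - z := by rw [abs_of_nonpos (by linarith [hz.2])]; ring
  simp [nash, extremeProfile, Fin.prod_univ_succ, util, h1, abs_of_nonneg hz.1, pow_succ']

theorem esw_extremeProfile (m : ℕ) {z : ℝ} (hz0 : 0 ≤ z) (hz : z ≤ 1 / 2) :
    esw z (extremeProfile m) = z := by
  have h1 : |z - 1| = 1 - z := by rw [abs_of_nonpos (by linarith)]; ring
  apply le_antisymm
  · simpa [extremeProfile, util, h1] using esw_le_util z (extremeProfile m) 0
  · refine le_ciInf fun i => Fin.cases ?_ (fun j => ?_) i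
    · simp [extremeProfile, util, h1]
    · simp only [extremeProfile, util, Fin.cons_succ, sub_zero, abs_of_nonneg hz0]
      linarith

theorem mid_extremeProfile (m : ℕ) : mid (extremeProfile m) = 1 / 2 := by
  have hmem : ∀ i, extremeProfile m i ∈ Set.Icc (0 : ℝ) 1 := fun i =>
    Fin.cases (by simp [extremeProfile]) (fun j => by simp [extremeProfile]) i
  have hinf : ⨅ i, extremeProfile m i = 0 :=
    le_antisymm (ciInf_le (Set.finite_range _).bddBelow (1 : Fin (m + 2)))
      (le_ciInf fun i => (hmem i).1)
  have hsup : ⨆ i, extremeProfile m i = 1 :=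
    le_antisymm (ciSup_le fun i => (hmem i).2)
      (le_ciSup (Set.finite_range (extremeProfile m)).bddAbove 0)
  rw [mid, hinf, hsup, zero_add]

theorem nashFL_egalitarian_approx (n : ℕ) (hn : 2 ≤ n) :
    (∀ x : Fin n → ℝ, (∀ i, x i ∈ Set.Icc (0 : ℝ) 1) →
      ∀ ystar, isNashOpt x ystar →
        ∀ y ∈ Set.Icc (0 : ℝ) 1, esw y x ≤ ((n : ℝ) / 2) * esw ystar x) ∧
    (∃ x : Fin n → ℝ, (∀ i, x i ∈ Set.Icc (0 : ℝ) 1) ∧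
      ∃ ystar, isNashOpt x ystar ∧ esw (mid x) x = ((n : ℝ) / 2) * esw ystar x) := by
  refine ⟨fun x hx ystar h y _ => h.esw_le hn hx y, ?_⟩
  obtain ⟨m, rfl⟩ := Nat.exists_eq_add_of_le' hn
  have hpos : (0 : ℝ) ≤ 1 / (m + 2) := by positivity
  have hhalf : 1 / ((m : ℝ) + 2) ≤ 1 / 2 :=
    one_div_le_one_div_of_le two_pos (by linarith [m.cast_nonneg (α := ℝ)])
  have hmem : 1 / ((m : ℝ) + 2) ∈ Set.Icc (0 : ℝ) 1 := ⟨hpos, by linarith⟩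
  refine ⟨extremeProfile m, fun i => Fin.cases (by simp [extremeProfile])
    (fun j => by simp [extremeProfile]) i, 1 / (m + 2), ⟨hmem, fun z hz => ?_⟩, ?_⟩
  · rw [nash_extremeProfile m hz, nash_extremeProfile m hmem]
    exact mul_one_sub_pow_le m hz.2
  · rw [mid_extremeProfile, esw_extremeProfile m (by norm_num) le_rfl,
      esw_extremeProfile m hpos hhalf]
    push_cast
    field_simp
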